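/- arXiv:1802.02454 — 2 statements merged into one kernel-verified Lean document; each statement's English description precedes it below -/
import Mathlib

section
/- Both endpoints c_inf and C_inf belong to the Lagrange spectrum L (in particular c_inf = l(overline(2_4 1_2 2_2 1)), the Lagrange value of the periodic bi-infinite sequence with period 2_4 1_2 2_2 1), while the open interval (c_inf, C_inf) is disjoint from L. Consequently, (c_inf, C_inf) is a maximal open interval contained in the complement of L. -/
open Filter Set

/-- Convergents of the continued fraction `[a 0; a 1, a 2, ...]`. -/
noncomputable def cfConv : (ℕ → ℕ) → ℕ → ℝ
  | a, 0 => (a 0 : ℝ)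
  | a, n + 1 => (a 0 : ℝ) + 1 / cfConv (fun i => a (i + 1)) n

/-- Value of the infinite continued fraction `[a 0; a 1, a 2, ...]`,
i.e. the limit of its convergents. -/
noncomputable def cfVal (a : ℕ → ℕ) : ℝ := limUnder atTop (cfConv a)

/-- Value of the infinite continued fraction `[0; g 0, g 1, g 2, ...]`. -/
noncomputable def cf0 (g : ℕ → ℕ) : ℝ :=
  cfVal (fun n => match n with | 0 => 0 | k + 1 => g k)

/-- `λ_i(A) = [a_i; a_{i+1}, ...] + [0; a_{i-1}, a_{i-2}, ...]` for a bi-infinite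
sequence `A`. -/
noncomputable def lam (A : ℤ → ℕ) (i : ℤ) : ℝ :=
  cfVal (fun n => A (i + n)) + cf0 (fun k => A (i - 1 - k))

/-- The Markov value `m(A) = sup_i λ_i(A)`. -/
noncomputable def markovVal (A : ℤ → ℕ) : ℝ := sSup (Set.range (lam A))

/-- The Lagrange value `ℓ(A) = limsup_{i → +∞} λ_i(A)`. -/
noncomputable def lagrangeVal (A : ℤ → ℕ) : ℝ := limsup (lam A) atTop

/-- The Markov spectrum (Perron's characterization). -/
def MarkovSpectrum : Set ℝ :=
  {x | ∃ A : ℤ → ℕ, (∀ n, 0 < A n) ∧ BddAbove (Set.range (lam A)) ∧ x = markovVal A}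

/-- The Lagrange spectrum (Perron's characterization). -/
def LagrangeSpectrum : Set ℝ :=
  {x | ∃ A : ℤ → ℕ, (∀ n, 0 < A n) ∧ IsBoundedUnder (· ≤ ·) atTop (lam A) ∧
    x = lagrangeVal A}

/-- The purely periodic one-sided sequence with period `w`. -/
def perSeq (w : List ℕ) : ℕ → ℕ := fun n => w.getD (n % w.length) 1

/-- The one-sided sequence beginning with the finite word `p` and continuing with `g`. -/
def catSeq (p : List ℕ) (g : ℕ → ℕ) : ℕ → ℕ :=
  fun n => if n < p.length then p.getD n 1 else g (n - p.length)

/-- The eventually periodic one-sided sequence with preperiod `p` and period `w`. -/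
def prePer (p w : List ℕ) : ℕ → ℕ := catSeq p (perSeq w)

/-- The periodic bi-infinite sequence with period `w`. -/
def perZ (w : List ℕ) : ℤ → ℕ := fun n => w.getD ((n % (w.length : ℤ)).toNat) 1

/-- `c_∞ = [overline(2_4 1_2 2_2 1)] + [0; overline(1 2_2 1_2 2_4)]`. -/
noncomputable def cInf : ℝ :=
  cfVal (perSeq [2,2,2,2,1,1,2,2,1]) + cf0 (perSeq [1,2,2,1,1,2,2,2,2])

/-- `C_∞ = [2; 1, 2_2, 1_2, 2_4, 1, 2_2, 1_2, 2_4, 1, 2_2, 1_2, 2_2, 1, 2_4, 1_2,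
overline(2_3 1_3)] + [0; 2_3, 1_2, 2_2, 1, 2_4, 1, overline(1_3 2_3)]`. -/
noncomputable def CInf : ℝ :=
  cfVal (prePer [2,1,2,2,1,1,2,2,2,2,1,2,2,1,1,2,2,2,2,1,2,2,1,1,2,2,1,2,2,2,2,1,1]
    [2,2,2,1,1,1]) +
  cf0 (prePer [2,2,2,1,1,2,2,1,2,2,2,2,1] [1,1,1,2,2,2])

/-- `f = [overline(2_4 1_2 2_2 1)] + [0; 1, 2_2, 1_2, 2_4, 1, 2_2, 1_2, 2_2, 1_2,
overline(2_3 1_3)]`. -/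
noncomputable def fV : ℝ :=
  cfVal (perSeq [2,2,2,2,1,1,2,2,1]) +
  cf0 (prePer [1,2,2,1,1,2,2,2,2,1,2,2,1,1,2,2,1,1] [2,2,2,1,1,1])

/-- `w` occurs in the bi-infinite sequence `A` starting at position `j`. -/
def occursAtZ (w : List ℕ) (A : ℤ → ℕ) (j : ℤ) : Prop :=
  ∀ i : ℕ, i < w.length → A (j + i) = w.getD i 0

/-- `w` occurs somewhere in the bi-infinite sequence `A`. -/
def occursInZ (w : List ℕ) (A : ℤ → ℕ) : Prop := ∃ j : ℤ, occursAtZ w A j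

/-- `w` occurs in the one-sided sequence `g` starting at position `k`. -/
def occursAtN (w : List ℕ) (g : ℕ → ℕ) (k : ℕ) : Prop :=
  ∀ i : ℕ, i < w.length → g (k + i) = w.getD i 0

/-- `w` occurs somewhere in the one-sided sequence `g`. -/
def occursInN (w : List ℕ) (g : ℕ → ℕ) : Prop := ∃ k : ℕ, occursAtN w g k

def W1 : List ℕ := [1,2,1]
def W2 : List ℕ := [2,2,1,2,2,2,1]
def W3 : List ℕ := [2,2,2,1,2,2,2]
def W4 : List ℕ := [2,2,2,2,2,1,2,2,1,1]
def W5 : List ℕ := [2,2,2,1,1,2,2,2,2,1,2,2,1,1,2,2,2]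
def W6 : List ℕ := [2,2,1,1,2,2,2,2,1,2,2,1,1,2,2,2,1]
def W7 : List ℕ := [1,1,2,2,1,1,2,2,2,2,1,2,2,1,1,2,2,2]
def W8 : List ℕ := [2,2,1,2,2,1,1,2,2,2,2,1,2,2,1,1,2,2,2,2,2]
def W9 : List ℕ := [1,2,2,1,2,2,1,1,2,2,2,2,1,2,2,1,1,2,2,2,2,1]
def W10 : List ℕ := [2,2,2,2,1,2,2,1,1,2,2,2,2,1,2,2,1,1,2,2,2,2,1,1]
def W11 : List ℕ := [2,2,2,2,1,2,2,1,1,2,2,2,2,1,2,2,1,1,2,2,2,2,1,2,2,1,2]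
def W12 : List ℕ := [1,2,2,2,2,1,2,2,1,1,2,2,2,2,1,2,2,1,1,2,2,2,2,1,2,2,1,1,1]
def W13 : List ℕ := [2,1,2,2,2,2,1,2,2,1,1,2,2,2,2,1,2,2,1,1,2,2,2,2,1,2,2,1,1,2,2]

/-- The list of the thirteen words `W_1, …, W_13`. -/
def Wall : List (List ℕ) := [W1,W2,W3,W4,W5,W6,W7,W8,W9,W10,W11,W12,W13]

/-- The words `W_1, …, W_13` together with the (0-based) position of their marked
digit `2^*`. -/
def markedW : List (List ℕ × ℕ) :=
  [(W1,1),(W2,3),(W3,4),(W4,4),(W5,8),(W6,7),(W7,9),(W8,10),(W9,11),(W10,12),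
   (W11,12),(W12,13),(W13,14)]

/-- The words `V_15, …, V_21` together with the (0-based) position of their marked
digit `2^*`. -/
def markedV : List (List ℕ × ℕ) :=
  [([1,1,2,2],2),
   ([2,2,1,2,2,1],3),
   ([2,2,2,2,1,2,2,1,2],3),
   ([1,2,2,2,2,1,2,2,1,1,1],4),
   ([1,2,2,2,2,1,2,2,1,1,2,2,1],4),
   ([2,1,2,2,2,2,1,2,2,1,1,2,2,2],5),
   ([1,1,1,2,2,2,2,1,2,2,1,1,2,2,2],6)]

/-- The word `2 1_2 2_4 1 2_2 1_2 2_3`. -/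
def spWord : List ℕ := [2,1,1,2,2,2,2,1,2,2,1,1,2,2,2]

/-- The set `P` of 27 forbidden words: `W_1, …, W_13`, their transposes, and
`2 1_2 2_4 1 2_2 1_2 2_3` together with its transpose. -/
def Pwords : List (List ℕ) := Wall ++ Wall.map List.reverse ++ [spWord, spWord.reverse]

/-- `g` contains no word of `P` as a consecutive subword. -/
def avoidsP (g : ℕ → ℕ) : Prop := ∀ w ∈ Pwords, ¬ occursInN w g

/-- The Cantor set `Y`. -/
noncomputable def Yset : Set ℝ :=
  {x | ∃ g : ℕ → ℕ, (∀ n, g n = 1 ∨ g n = 2) ∧ avoidsP g ∧ x = cf0 g}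

/-- The word `1_2 2_4 1 2_2 1_2 2_4 1 2_2 1_2 2_4 1 2_2 1_2 2_2`. -/
def bigWord : List ℕ :=
  [1,1,2,2,2,2,1,2,2,1,1,2,2,2,2,1,2,2,1,1,2,2,2,2,1,2,2,1,1,2,2]

/-- The word `1_3 2_4 1 2_2 1_2 2_4 1 2_2 1_2 2_4 1 2_2 1_2 2_2`. -/
def bigWord13 : List ℕ := 1 :: bigWord

/-- `g` is an infinite concatenation of the blocks `(1,1)` and `(2,2)`. -/
def isBlockSeq (g : ℕ → ℕ) : Prop :=
  ∀ n, (g (2*n) = 1 ∧ g (2*n+1) = 1) ∨ (g (2*n) = 2 ∧ g (2*n+1) = 2)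

/-- The Gauss–Cantor set `K({1_2, 2_2})`. -/
noncomputable def Kset : Set ℝ := {x | ∃ g : ℕ → ℕ, isBlockSeq g ∧ x = cf0 g}

/-- The truncated continued fraction `[0; g 0, ..., g (n - 1)]`. -/
noncomputable def truncCF : (ℕ → ℕ) → ℕ → ℝ
  | _, 0 => 0
  | g, n + 1 => 1 / (g 0 + truncCF (fun i => g (i + 1)) n)

lemma cfConv_eq_add_truncCF (a : ℕ → ℕ) (n : ℕ) :
    cfConv a n = a 0 + truncCF (fun i => a (i + 1)) n := by
  induction n generalizing a with
  | zero => simp [cfConv, truncCF]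
  | succ n ih => rw [cfConv, truncCF, ih]

lemma cfConv_zero_cons (g : ℕ → ℕ) (n : ℕ) :
    cfConv (fun n => match n with | 0 => 0 | k + 1 => g k) n = truncCF g n := by
  simp [cfConv_eq_add_truncCF]

lemma truncCF_mem_Icc {g : ℕ → ℕ} (hg : ∀ n, 0 < g n) (n : ℕ) : truncCF g n ∈ Icc (0 : ℝ) 1 := by
  induction n generalizing g with
  | zero => simp [truncCF]
  | succ n ih =>
    have h := ih (g := fun i => g (i + 1)) (fun i => hg _)
    have h0 : (1 : ℝ) ≤ g 0 := by exact_mod_cast hg 0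
    rw [truncCF]
    refine ⟨div_nonneg zero_le_one (by linarith [h.1]), ?_⟩
    rw [div_le_one (by linarith [h.1])]
    linarith [h.1]

lemma abs_inv_inv_sub_le {a b x y : ℝ} (ha : 1 ≤ a) (hb : 1 ≤ b) (hx : 0 ≤ x) (hy : 0 ≤ y) :
    |1 / (a + 1 / (b + x)) - 1 / (a + 1 / (b + y))| ≤ |x - y| / 4 := by
  have h1 : 0 < b + x := by linarith
  have h2 : 0 < b + y := by linarith
  have h3 : 2 ≤ a * (b + x) + 1 := by nlinarith
  have h4 : 2 ≤ a * (b + y) + 1 := by nlinarith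
  have h : 1 / (a + 1 / (b + x)) - 1 / (a + 1 / (b + y)) =
      (x - y) / ((a * (b + x) + 1) * (a * (b + y) + 1)) := by
    field_simp
    ring
  rw [h, abs_div, abs_of_pos (by positivity : 0 < (a * (b + x) + 1) * (a * (b + y) + 1))]
  exact div_le_div_of_nonneg_left (abs_nonneg _) (by norm_num) (by nlinarith)

lemma abs_truncCF_sub_le {g h : ℕ → ℕ} (hg : ∀ n, 0 < g n) (hh : ∀ n, 0 < h n) {k m n : ℕ}
    (hgh : ∀ i < k, g i = h i) (hm : k ≤ m) (hn : k ≤ n) :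
    |truncCF g m - truncCF h n| ≤ 2 * (1 / 2) ^ k := by
  induction k using Nat.twoStepInduction generalizing g h m n with
  | zero =>
    have h1 := truncCF_mem_Icc hg m
    have h2 := truncCF_mem_Icc hh n
    rw [abs_le]
    constructor <;> norm_num <;> linarith [h1.1, h1.2, h2.1, h2.2]
  | one =>
    have h1 := truncCF_mem_Icc hg m
    have h2 := truncCF_mem_Icc hh n
    rw [abs_le]
    constructor <;> norm_num <;> linarith [h1.1, h1.2, h2.1, h2.2]
  | more k ih _ =>
    obtain ⟨m, rfl⟩ : ∃ m', m = m' + 2 := ⟨m - 2, by omega⟩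
    obtain ⟨n, rfl⟩ : ∃ n', n = n' + 2 := ⟨n - 2, by omega⟩
    have h0 : g 0 = h 0 := hgh 0 (by omega)
    have h1 : g 1 = h 1 := hgh 1 (by omega)
    have hle := ih (g := fun i => g (i + 2)) (h := fun i => h (i + 2)) (m := m) (n := n)
      (fun _ => hg _) (fun _ => hh _) (fun i hi => hgh (i + 2) (by omega)) (by omega) (by omega)
    have hx := (truncCF_mem_Icc (g := fun i => g (i + 2)) (fun _ => hg _) m).1
    have hy := (truncCF_mem_Icc (g := fun i => h (i + 2)) (fun _ => hh _) n).1
    have ha : (1 : ℝ) ≤ h 0 := by exact_mod_cast hh 0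
    have hb : (1 : ℝ) ≤ h 1 := by exact_mod_cast hh 1
    have key := abs_inv_inv_sub_le ha hb hx hy
    simp only [truncCF, zero_add, h0, h1]
    refine key.trans ?_
    rw [pow_add]
    linarith

lemma tendsto_truncCF {g : ℕ → ℕ} (hg : ∀ n, 0 < g n) :
    Tendsto (truncCF g) atTop (nhds (cf0 g)) := by
  have hc : CauchySeq (truncCF g) := by
    refine cauchySeq_of_le_tendsto_0 (fun k => 2 * (1 / 2 : ℝ) ^ k) ?_ ?_
    · intro m n k hm hn
      exact abs_truncCF_sub_le hg hg (fun _ _ => rfl) hm hn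
    · simpa using (tendsto_pow_atTop_nhds_zero_of_lt_one (r := (1 / 2 : ℝ)) (by norm_num)
        (by norm_num)).const_mul 2
  have he : cf0 g = limUnder atTop (truncCF g) :=
    congrArg (limUnder atTop) (funext (cfConv_zero_cons g))
  rw [he]
  exact tendsto_nhds_limUnder (cauchySeq_tendsto_of_complete hc)

lemma cf0_mem_Icc {g : ℕ → ℕ} (hg : ∀ n, 0 < g n) : cf0 g ∈ Icc (0 : ℝ) 1 :=
  isClosed_Icc.mem_of_tendsto (tendsto_truncCF hg) (Eventually.of_forall (truncCF_mem_Icc hg))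

lemma cf0_eq {g : ℕ → ℕ} (hg : ∀ n, 0 < g n) :
    cf0 g = 1 / (g 0 + cf0 (fun i => g (i + 1))) := by
  have h0 : (1 : ℝ) ≤ g 0 := by exact_mod_cast hg 0
  have ht := tendsto_truncCF (g := fun i => g (i + 1)) (fun _ => hg _)
  have hp := cf0_mem_Icc (g := fun i => g (i + 1)) (fun _ => hg _)
  refine tendsto_nhds_unique ((tendsto_add_atTop_iff_nat 1).2 (tendsto_truncCF hg)) ?_
  exact tendsto_const_nhds.div (tendsto_const_nhds.add ht) (by linarith [hp.1])

lemma cfVal_eq {a : ℕ → ℕ} (ha : ∀ n, 0 < a (n + 1)) :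
    cfVal a = a 0 + cf0 (fun i => a (i + 1)) := by
  have he : cfConv a = fun n => (a 0 : ℝ) + truncCF (fun i => a (i + 1)) n :=
    funext (cfConv_eq_add_truncCF a)
  rw [cfVal, he]
  exact ((tendsto_truncCF ha).const_add _).limUnder_eq

/-- Continued fractions sharing their first `k` partial quotients are `2 ^ (1 - k)`-close. -/
lemma abs_cf0_sub_le {g h : ℕ → ℕ} (hg : ∀ n, 0 < g n) (hh : ∀ n, 0 < h n) {k : ℕ}
    (hgh : ∀ i < k, g i = h i) : |cf0 g - cf0 h| ≤ 2 * (1 / 2) ^ k := by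
  refine le_of_tendsto ((tendsto_truncCF hg).sub (tendsto_truncCF hh)).abs ?_
  filter_upwards [eventually_ge_atTop k] with n hn
  exact abs_truncCF_sub_le hg hh hgh hn hn

/-- Comparison at the first differing partial quotient: a continued fraction decreases when a
partial quotient of even index increases, and increases for odd indices. -/
lemma cf0_le_cf0 {g h : ℕ → ℕ} (hg : ∀ n, 0 < g n) (hh : ∀ n, 0 < h n) {n : ℕ}
    (hgh : ∀ i < n, g i = h i) (hn : if Even n then g n < h n else h n < g n) :
    cf0 h ≤ cf0 g := by
  induction n generalizing g h with
  | zero =>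
    have hlt : (g 0 : ℝ) + 1 ≤ h 0 := by exact_mod_cast (by simpa using hn : g 0 < h 0)
    have hx := cf0_mem_Icc (g := fun i => g (i + 1)) (fun _ => hg _)
    have hy := cf0_mem_Icc (g := fun i => h (i + 1)) (fun _ => hh _)
    have h0 : (0 : ℝ) < g 0 := by exact_mod_cast hg 0
    rw [cf0_eq hg, cf0_eq hh]
    exact one_div_le_one_div_of_le (by linarith [hx.1]) (by linarith [hx.2, hy.1])
  | succ n ih =>
    have h0 : g 0 = h 0 := hgh 0 (by omega)
    have hle := ih (g := fun i => h (i + 1)) (h := fun i => g (i + 1)) (fun _ => hh _)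
      (fun _ => hg _) (fun i hi => (hgh (i + 1) (by omega)).symm) (by
        simp only [Nat.even_add_one] at hn ⊢
        split_ifs with h <;> simpa [h] using hn)
    have hx := cf0_mem_Icc (g := fun i => g (i + 1)) (fun _ => hg _)
    have hp : (0 : ℝ) < h 0 := by exact_mod_cast hh 0
    rw [cf0_eq hg, cf0_eq hh, h0]
    exact one_div_le_one_div_of_le (by linarith [hx.1]) (by linarith)

/-- If `g` can leave `h` only in the direction that increases the continued fraction, at least
during the first `m` partial quotients, then `cf0 h` is almost a lower bound of `cf0 g`. -/
lemma cf0_sub_le_of_deviation {g h : ℕ → ℕ} (hg : ∀ n, 0 < g n) (hh : ∀ n, 0 < h n) (m : ℕ)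
    (hdev : ∀ n < m, (∀ i < n, g i = h i) →
      g n = h n ∨ if Even n then g n < h n else h n < g n) :
    cf0 h - 2 * (1 / 2) ^ m ≤ cf0 g := by
  by_cases hall : ∀ i < m, g i = h i
  · linarith [(abs_le.1 (abs_cf0_sub_le hg hh hall)).1]
  · push Not at hall
    classical
    obtain ⟨hlt, hne⟩ := Nat.find_spec hall
    have heq : ∀ i < Nat.find hall, g i = h i := fun i hi => by
      have := Nat.find_min hall hi
      push Not at this
      exact this (hi.trans hlt)
    have := cf0_le_cf0 hg hh heq ((hdev _ hlt heq).resolve_left hne)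
    have : (0 : ℝ) ≤ 2 * (1 / 2) ^ m := by positivity
    linarith

lemma lam_eq {A : ℤ → ℕ} (hA : ∀ n, 0 < A n) (i : ℤ) :
    lam A i = A i + cf0 (fun k => A (i + 1 + k)) + cf0 (fun k => A (i - 1 - k)) := by
  rw [lam, cfVal_eq (fun _ => hA _)]
  simp only [Nat.cast_zero, add_zero, Nat.cast_add, Nat.cast_one, add_assoc, add_comm (1 : ℤ)]

lemma lam_reflect {A : ℤ → ℕ} (hA : ∀ n, 0 < A n) (i : ℤ) :
    lam (fun n => A (-n)) i = lam A (-i) := by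
  rw [lam_eq hA, lam_eq (fun _ => hA _), add_right_comm]
  congr 3 <;> ext k <;> congr 1 <;> ring

lemma abs_lam_sub_le {A B : ℤ → ℕ} (hA : ∀ n, 0 < A n) (hB : ∀ n, 0 < B n) {i j : ℤ} {m : ℕ}
    (h : ∀ k : ℤ, |k| ≤ m → A (i + k) = B (j + k)) :
    |lam A i - lam B j| ≤ 4 * (1 / 2) ^ m := by
  have h0 : A i = B j := by simpa using h 0 (by simp)
  have hr := abs_cf0_sub_le (g := fun k => A (i + 1 + k)) (h := fun k => B (j + 1 + k)) (k := m)
    (fun _ => hA _) (fun _ => hB _) (fun k hk => by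
      simpa [add_assoc] using h (1 + k) (by rw [abs_of_nonneg] <;> omega))
  have hl := abs_cf0_sub_le (g := fun k => A (i - 1 - k)) (h := fun k => B (j - 1 - k)) (k := m)
    (fun _ => hA _) (fun _ => hB _) (fun k hk => by
      have := h (-(1 + k)) (by rw [abs_neg, abs_of_nonneg] <;> omega)
      convert this using 2 <;> ring)
  rw [lam_eq hA, lam_eq hB, h0]
  rw [abs_le] at *
  constructor <;> linarith [hr.1, hr.2, hl.1, hl.2]

/-- The finite word `l` is a prefix of the infinite word `g`. -/
def IsPrefixOf (l : List ℕ) (g : ℕ → ℕ) : Prop := ∀ k d, l[k]? = some d → g k = d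

lemma IsPrefixOf.mono {l l' : List ℕ} {g : ℕ → ℕ} (h : IsPrefixOf l' g)
    (hl : l.isPrefixOf l' = true) : IsPrefixOf l g := by
  obtain ⟨t, rfl⟩ : l <+: l' := by simpa using hl
  intro k d hk
  refine h k d ?_
  obtain ⟨hlt, -⟩ := List.getElem?_eq_some_iff.1 hk
  rw [List.getElem?_append_left hlt, hk]

lemma isPrefixOf_nil (g : ℕ → ℕ) : IsPrefixOf [] g := by simp [IsPrefixOf]

lemma isPrefixOf_cons {d : ℕ} {l : List ℕ} {g : ℕ → ℕ} :
    IsPrefixOf (d :: l) g ↔ g 0 = d ∧ IsPrefixOf l (fun k => g (k + 1)) := by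
  constructor
  · exact fun h => ⟨h 0 d (by simp), fun k e hk => h (k + 1) e (by simpa using hk)⟩
  · rintro ⟨h0, h⟩ (_ | k) e hk
    · simp_all
    · exact h k e (by simpa using hk)

lemma IsPrefixOf.concat {l : List ℕ} {g : ℕ → ℕ} {d : ℕ} (h : IsPrefixOf l g)
    (hd : g l.length = d) : IsPrefixOf (l ++ [d]) g := by
  intro k e hk
  rcases lt_trichotomy k l.length with hlt | rfl | hgt
  · exact h k e (by rwa [List.getElem?_append_left hlt] at hk)
  · simp at hk
    omega
  · rw [List.getElem?_eq_none (by simp; omega)] at hk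
    cases hk

/-- Numerator and denominator of an upper (`true`) or lower (`false`) bound for the continued
fractions `[0; l, ...]`. -/
def cfBound : Bool → List ℕ → ℕ × ℕ
  | b, [] => (b.toNat, 1)
  | b, d :: l => ((cfBound (!b) l).2, d * (cfBound (!b) l).2 + (cfBound (!b) l).1)

lemma cfBound_spec {l : List ℕ} {g : ℕ → ℕ} (hg : ∀ n, 0 < g n) (h : IsPrefixOf l g) (b : Bool) :
    0 < (cfBound b l).2 ∧ bif b
      then cf0 g * (cfBound b l).2 ≤ (cfBound b l).1
      else ((cfBound b l).1 : ℝ) ≤ cf0 g * (cfBound b l).2 := by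
  induction l generalizing g b with
  | nil =>
    have := cf0_mem_Icc hg
    cases b <;> simp [cfBound, this.1, this.2]
  | cons d l ih =>
    obtain ⟨rfl, hl⟩ := isPrefixOf_cons.1 h
    obtain ⟨hpos, hle⟩ := ih (g := fun k => g (k + 1)) (fun _ => hg _) hl (!b)
    have hx := (cf0_mem_Icc (g := fun k => g (k + 1)) (fun _ => hg _)).1
    have h0 : (0 : ℝ) < g 0 := by exact_mod_cast hg 0
    refine ⟨Nat.add_pos_left (Nat.mul_pos (hg 0) hpos) _, ?_⟩
    rw [cf0_eq hg, cfBound]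
    have hden : 0 < (g 0 : ℝ) + cf0 (fun k => g (k + 1)) := by linarith
    cases b <;> simp only [cond_true, cond_false, Bool.not_true, Bool.not_false] at hle ⊢ <;>
      push_cast
    · rw [one_div_mul_eq_div, le_div_iff₀ hden]
      nlinarith
    · rw [one_div_mul_eq_div, div_le_iff₀ hden]
      nlinarith

/-- Numerator and denominator of an upper (`true`) or lower (`false`) bound for the value of `lam`
at a digit `d` with `L` to its left (read leftwards) and `R` to its right. -/
def lamBound (b : Bool) (L : List ℕ) (d : ℕ) (R : List ℕ) : ℕ × ℕ :=
  let x := cfBound b L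
  let y := cfBound b R
  (d * (x.2 * y.2) + x.1 * y.2 + y.1 * x.2, x.2 * y.2)

lemma lamBound_spec {A : ℤ → ℕ} (hA : ∀ n, 0 < A n) {i : ℤ} {L R : List ℕ}
    (hL : IsPrefixOf L (fun k => A (i - 1 - k))) (hR : IsPrefixOf R (fun k => A (i + 1 + k)))
    (b : Bool) : 0 < (lamBound b L (A i) R).2 ∧ bif b
      then lam A i * (lamBound b L (A i) R).2 ≤ (lamBound b L (A i) R).1
      else ((lamBound b L (A i) R).1 : ℝ) ≤ lam A i * (lamBound b L (A i) R).2 := by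
  obtain ⟨hx, hxb⟩ := cfBound_spec (fun _ => hA _) hL b
  obtain ⟨hy, hyb⟩ := cfBound_spec (fun _ => hA _) hR b
  refine ⟨Nat.mul_pos hx hy, ?_⟩
  rw [lam_eq hA, lamBound]
  have hx' : (0 : ℝ) < (cfBound b L).2 := by exact_mod_cast hx
  have hy' : (0 : ℝ) < (cfBound b R).2 := by exact_mod_cast hy
  cases b <;> simp only [cond_true, cond_false] at hxb hyb ⊢ <;> push_cast <;>
    linarith [mul_le_mul_of_nonneg_right hxb hy'.le, mul_le_mul_of_nonneg_right hyb hx'.le]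

/-- The surroundings `L` (leftwards) and `R` of a digit `d` force `lam` to be at least
`3.1181201784`. -/
def exceeds (L : List ℕ) (d : ℕ) (R : List ℕ) : Bool :=
  Nat.ble (31181201784 * (lamBound false L d R).2) (10000000000 * (lamBound false L d R).1)

/-- The surroundings `L` (leftwards) and `R` of a digit `d` force `lam` to be at most
`3.118120178`. -/
def isSmall (L : List ℕ) (d : ℕ) (R : List ℕ) : Bool :=
  Nat.ble (1000000000 * (lamBound true L d R).1) (3118120178 * (lamBound true L d R).2)

lemma le_lam_of_exceeds {A : ℤ → ℕ} (hA : ∀ n, 0 < A n) {i : ℤ} {L R : List ℕ}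
    (hL : IsPrefixOf L (fun k => A (i - 1 - k))) (hR : IsPrefixOf R (fun k => A (i + 1 + k)))
    (h : exceeds L (A i) R = true) : (3.1181201784 : ℝ) ≤ lam A i := by
  obtain ⟨hpos, hle⟩ := lamBound_spec hA hL hR false
  rw [cond_false] at hle
  have h' : (31181201784 * (lamBound false L (A i) R).2 : ℝ) ≤
      10000000000 * (lamBound false L (A i) R).1 := by exact_mod_cast Nat.le_of_ble_eq_true h
  have hpos' : (0 : ℝ) < (lamBound false L (A i) R).2 := by exact_mod_cast hpos
  refine le_of_mul_le_mul_right ?_ hpos'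
  linarith

lemma lam_le_of_isSmall {A : ℤ → ℕ} (hA : ∀ n, 0 < A n) {i : ℤ} {L R : List ℕ}
    (hL : IsPrefixOf L (fun k => A (i - 1 - k))) (hR : IsPrefixOf R (fun k => A (i + 1 + k)))
    (h : isSmall L (A i) R = true) : lam A i ≤ 3.118120178 := by
  obtain ⟨hpos, hle⟩ := lamBound_spec hA hL hR true
  rw [cond_true] at hle
  have h' : (1000000000 * (lamBound true L (A i) R).1 : ℝ) ≤
      3118120178 * (lamBound true L (A i) R).2 := by exact_mod_cast Nat.le_of_ble_eq_true h
  have hpos' : (0 : ℝ) < (lamBound true L (A i) R).2 := by exact_mod_cast hpos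
  refine le_of_mul_le_mul_right ?_ hpos'
  linarith

/-- Around the cut just before position `j`, the sequence `A` reads `L` leftwards and `R`
rightwards. -/
def Reads (A : ℤ → ℕ) (j : ℤ) (L R : List ℕ) : Prop :=
  IsPrefixOf L (fun k => A (j - 1 - k)) ∧ IsPrefixOf R (fun k => A (j + k))

lemma reads_cons_right {A : ℤ → ℕ} {j : ℤ} {L R : List ℕ} {d : ℕ} :
    Reads A j L (d :: R) ↔ Reads A (j + 1) (d :: L) R := by
  simp only [Reads, isPrefixOf_cons, Nat.cast_zero, add_zero, sub_zero, add_sub_cancel_right,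
    Nat.cast_add, Nat.cast_one]
  have h1 : ∀ k : ℕ, j - (k + 1) = j - 1 - k := fun k => by ring
  have h2 : ∀ k : ℕ, j + (k + 1) = j + 1 + k := fun k => by ring
  simp only [h1, h2]
  tauto

lemma Reads.reverseAux {A : ℤ → ℕ} {j : ℤ} {L R : List ℕ} (h : Reads A j L R) :
    Reads A (j - L.length) [] (L.reverseAux R) := by
  induction L generalizing j R with
  | nil => simpa using h
  | cons d L ih =>
    have := ih (j := j - 1) (R := d :: R) (reads_cons_right.2 (by simpa using h))
    rwa [show j - ((d :: L).length : ℤ) = j - 1 - L.length by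
      rw [List.length_cons]; push_cast; ring]

/-- Some digit `2` of the word `L.reverse ++ R` within `R` forces `lam` to be at least
`3.1181201784`. -/
def anyExceeds : List ℕ → List ℕ → Bool
  | _, [] => false
  | L, d :: R => (Nat.beq d 2 && exceeds L d R) || anyExceeds (d :: L) R

/-- On the integer interval `[a, b]` the digits of `A` are `1` or `2` and `lam A` is bounded by
`3.1181201784`. -/
def GoodOn (A : ℤ → ℕ) (a b : ℤ) : Prop :=
  ∀ i, a ≤ i → i ≤ b → (A i = 1 ∨ A i = 2) ∧ lam A i < 3.1181201784

lemma anyExceeds_eq_false {A : ℤ → ℕ} (hA : ∀ n, 0 < A n) {j : ℤ} {L R : List ℕ}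
    (hgood : GoodOn A j (j + R.length)) (h : Reads A j L R) : anyExceeds L R = false := by
  induction R generalizing j L with
  | nil => rfl
  | cons d R ih =>
    have hs := reads_cons_right.1 h
    rw [anyExceeds, ih (fun i h1 h2 => hgood i (by omega) (by push_cast [List.length_cons]; omega))
      hs, Bool.or_false]
    obtain rfl : A j = d := by simpa using (isPrefixOf_cons.1 h.2).1
    by_contra hne
    have hex : exceeds L (A j) R = true := by simp_all
    exact absurd (hgood j le_rfl (by omega)).2 (not_lt.2 (le_lam_of_exceeds hA h.1 hs.2 hex))

/-- Extends the word `L.reverse ++ R` to both sides by at most `n` digits `1` and `2`, until `halt`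
holds or some digit exceeds the bound on `lam`. -/
def search (halt : List ℕ → List ℕ → Bool) : ℕ → List ℕ → List ℕ → Bool
  | 0, L, R => halt L R || anyExceeds [] (L.reverseAux R)
  | n + 1, L, R => halt L R || anyExceeds [] (L.reverseAux R) ||
      (bif Nat.blt L.length R.length
        then search halt n (L ++ [1]) R && search halt n (L ++ [2]) R
        else search halt n L (R ++ [1]) && search halt n L (R ++ [2]))

lemma exists_halt_of_search {A : ℤ → ℕ} (hA : ∀ n, 0 < A n) {halt : List ℕ → List ℕ → Bool}
    {n : ℕ} {L R : List ℕ} {j : ℤ} (h : search halt n L R = true) (hr : Reads A j L R)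
    (hgood : GoodOn A (j - L.length - n) (j + R.length + n)) :
    ∃ L' R', halt L' R' = true ∧ Reads A j L' R' := by
  have hno : anyExceeds [] (L.reverseAux R) = false := by
    refine anyExceeds_eq_false hA (fun i h1 h2 => hgood i (by omega) ?_) hr.reverseAux
    simp only [List.reverseAux_eq, List.length_append, List.length_reverse] at h2
    omega
  induction n generalizing L R with
  | zero =>
    rw [search, hno, Bool.or_false] at h
    exact ⟨L, R, h, hr⟩
  | succ n ih =>
    have step : ∀ L' R', search halt n L' R' = true → Reads A j L' R' →
        L'.length + R'.length = L.length + R.length + 1 → L.length ≤ L'.length →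
        R.length ≤ R'.length → ∃ L' R', halt L' R' = true ∧ Reads A j L' R' := by
      intro L' R' hs hr' h1 h2 h3
      refine ih hs hr' (fun i h4 h5 => hgood i (by push_cast; omega) (by push_cast; omega)) ?_
      refine anyExceeds_eq_false hA (fun i h4 h5 => hgood i (by push_cast; omega) ?_) hr'.reverseAux
      simp only [List.reverseAux_eq, List.length_append, List.length_reverse] at h5
      push_cast
      omega
    rw [search, hno, Bool.or_false, Bool.or_eq_true] at h
    rcases h with h | h
    · exact ⟨L, R, h, hr⟩
    cases hb : Nat.blt L.length R.length <;>
      simp only [hb, cond_true, cond_false, Bool.and_eq_true] at h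
    · rcases (hgood (j + R.length) (by push_cast; omega) (by push_cast; omega)).1 with hd | hd
      · exact step L _ h.1 ⟨hr.1, hr.2.concat hd⟩ (by simp; omega) (by simp) (by simp)
      · exact step L _ h.2 ⟨hr.1, hr.2.concat hd⟩ (by simp; omega) (by simp) (by simp)
    · rcases (hgood (j - 1 - L.length) (by push_cast; omega) (by push_cast; omega)).1 with hd | hd
      · exact step _ R h.1 ⟨hr.1.concat hd, hr.2⟩ (by simp; omega) (by simp) (by simp)
      · exact step _ R h.2 ⟨hr.1.concat hd, hr.2⟩ (by simp; omega) (by simp) (by simp)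

lemma GoodOn.mono {A : ℤ → ℕ} {a b a' b' : ℤ} (h : GoodOn A a b) (ha : a ≤ a') (hb : b' ≤ b) :
    GoodOn A a' b' := fun i h1 h2 => h i (ha.trans h1) (h2.trans hb)

lemma GoodOn.reflect {A : ℤ → ℕ} (hA : ∀ n, 0 < A n) {a b : ℤ} (h : GoodOn A a b) :
    GoodOn (fun n => A (-n)) (-b) (-a) := by
  intro i h1 h2
  rw [lam_reflect hA]
  exact h (-i) (by omega) (by omega)

lemma Reads.reflect {A : ℤ → ℕ} {j : ℤ} {L R : List ℕ} (h : Reads A j L R) :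
    Reads (fun n => A (-n)) (1 - j) R L := by
  constructor
  · convert h.2 using 3
    ring
  · convert h.1 using 3
    ring

/-- The digit at index `n` that makes a continued fraction `[0; g 0, g 1, ...]` with partial
quotients `1` and `2` as small as possible. -/
def smallestDigit (n : ℕ) : ℕ := 2 - n % 2

/-- The word `g 0 ... g (n - 1)`, preceded by `L`, read leftwards. -/
def leftContext (g : ℕ → ℕ) (L : List ℕ) : ℕ → List ℕ
  | 0 => L
  | n + 1 => g n :: leftContext g L n

lemma reads_leftContext {A : ℤ → ℕ} {j : ℤ} {L : List ℕ} {g : ℕ → ℕ} (h : Reads A j L []) (n : ℕ)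
    (hg : ∀ k < n, A (j + k) = g k) : Reads A (j + n) (leftContext g L n) [] := by
  induction n with
  | zero => simpa [leftContext] using h
  | succ n ih =>
    have := ih (fun k hk => hg k (by omega))
    rw [Nat.cast_succ, ← add_assoc]
    refine reads_cons_right.1 ⟨this.1, isPrefixOf_cons.2 ⟨?_, isPrefixOf_nil _⟩⟩
    simpa using hg n (by omega)

lemma length_leftContext (g : ℕ → ℕ) (L : List ℕ) (n : ℕ) :
    (leftContext g L n).length = L.length + n := by
  induction n with
  | zero => rfl
  | succ n ih => rw [leftContext, List.length_cons, ih, add_assoc]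

/-- After the word `L` (read leftwards), a sequence following `g` at least up to index `s` cannot
leave `g` before index `50` by a digit `smallestDigit n` without exceeding the bound on `lam`. -/
def noEarlyDescent (g : ℕ → ℕ) (L : List ℕ) (s : ℕ) : Bool :=
  (List.range 50).all fun n => Nat.blt n s || Nat.beq (g n) (smallestDigit n) ||
    search (fun _ _ => false) 16 (leftContext g L n) [smallestDigit n]

/-- The analogue of `noEarlyDescent` for the six indices starting from `50`, using only the twelve
preceding digits. -/
def noLateDescent (g : ℕ → ℕ) : Bool :=
  (List.range 6).all fun k => Nat.beq (g (50 + k)) (smallestDigit (50 + k)) ||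
    search (fun _ _ => false) 8 (leftContext (fun t => g (38 + k + t)) [] 12)
      [smallestDigit (50 + k)]

lemma eq_add_mul_six {g : ℕ → ℕ} (hper : ∀ n, 38 ≤ n → g (n + 6) = g n) {n : ℕ} (hn : 38 ≤ n)
    (q : ℕ) : g (n + 6 * q) = g n := by
  induction q with
  | zero => rfl
  | succ q ih => rw [mul_add, ← add_assoc, mul_one, hper _ (by omega), ih]

lemma cf0_sub_le_of_noDescent {A : ℤ → ℕ} (hA : ∀ n, 0 < A n) {j : ℤ} {L : List ℕ} {g : ℕ → ℕ}
    {s m : ℕ} (hg : ∀ n, g n = 1 ∨ g n = 2) (hper : ∀ n, 38 ≤ n → g (n + 6) = g n)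
    (hearly : noEarlyDescent g L s = true) (hlate : noLateDescent g = true) (hr : Reads A j L [])
    (hs : ∀ n < s, A (j + n) = g n) (hgood : GoodOn A (j - L.length - 16) (j + m + 70)) :
    cf0 g - 2 * (1 / 2) ^ m ≤ cf0 (fun k => A (j + k)) := by
  refine cf0_sub_le_of_deviation (fun _ => hA _) (fun n => by have := hg n; omega) m
    fun n hn heq => ?_
  have hdigit := (hgood (j + n) (by omega) (by omega)).1
  suffices h : A (j + n) = smallestDigit n → g n = smallestDigit n by
    have := hg n
    unfold smallestDigit at h
    split_ifs with hev
    · rw [Nat.even_iff] at hev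
      omega
    · rw [Nat.even_iff] at hev
      omega
  intro hAn
  by_contra hne
  have hend : IsPrefixOf [smallestDigit n] (fun k => A (j + n + k)) :=
    isPrefixOf_cons.2 ⟨by simpa using hAn, isPrefixOf_nil _⟩
  rcases lt_or_ge n 50 with h50 | h50
  · have h := List.all_eq_true.1 hearly n (List.mem_range.2 h50)
    simp only [Bool.or_eq_true, Nat.blt_eq, Nat.beq_eq, hne, or_false] at h
    rcases h with h | h
    · exact hne ((hs n h).symm.trans hAn)
    · obtain ⟨_, _, h, -⟩ := exists_halt_of_search hA h ⟨(reads_leftContext hr n heq).1, hend⟩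
        (hgood.mono (by rw [length_leftContext]; push_cast; omega) (by simp; omega))
      cases h
  · obtain ⟨k, q, hk, rfl⟩ : ∃ k q, k < 6 ∧ n = 50 + k + 6 * q :=
      ⟨(n - 50) % 6, (n - 50) / 6, Nat.mod_lt _ (by norm_num), by omega⟩
    have hsd : smallestDigit (50 + k + 6 * q) = smallestDigit (50 + k) := by
      unfold smallestDigit
      omega
    rw [eq_add_mul_six hper (by omega), hsd] at hne
    rw [hsd] at hend
    have h := List.all_eq_true.1 hlate k (List.mem_range.2 hk)
    simp only [Bool.or_eq_true, Nat.beq_eq, hne, false_or] at h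
    have hr' := reads_leftContext (A := A) (j := j + (38 + k + 6 * q : ℕ)) (L := [])
      (g := fun t => g (38 + k + t)) ⟨isPrefixOf_nil _, isPrefixOf_nil _⟩ 12 (fun t ht => by
        rw [add_assoc, ← Nat.cast_add, heq _ (by omega),
          show 38 + k + 6 * q + t = 38 + k + t + 6 * q by omega, eq_add_mul_six hper (by omega)])
    rw [show j + (38 + k + 6 * q : ℕ) + (12 : ℕ) = j + (50 + k + 6 * q : ℕ) by
      push_cast; ring] at hr'
    obtain ⟨_, _, h, -⟩ := exists_halt_of_search hA h ⟨hr'.1, hend⟩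
      (hgood.mono (by rw [length_leftContext]; push_cast; simp; omega)
        (by push_cast; simp; omega))
    cases h

/-- The word of `bigWord13` before its marked digit, read leftwards. -/
def bigLeft : List ℕ := [2,2,2,1,1,2,2,1,2,2,2,2,1,1,1]

/-- The word of `bigWord13` after its marked digit. -/
def bigRight : List ℕ := [1,2,2,1,1,2,2,2,2,1,2,2,1,1,2,2]

/-- The partial quotients to the left of the central digit in `CInf`. -/
def gapLeft : ℕ → ℕ := prePer [2,2,2,1,1,2,2,1,2,2,2,2,1] [1,1,1,2,2,2]

/-- The partial quotients to the right of the central digit in `CInf`. -/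
def gapRight : ℕ → ℕ :=
  prePer [1,2,2,1,1,2,2,2,2,1,2,2,1,1,2,2,2,2,1,2,2,1,1,2,2,1,2,2,2,2,1,1] [2,2,2,1,1,1]

lemma getD_one_mem {l : List ℕ} (h : ∀ d ∈ l, d = 1 ∨ d = 2) (n : ℕ) :
    l.getD n 1 = 1 ∨ l.getD n 1 = 2 := by
  rcases lt_or_ge n l.length with hn | hn
  · rw [List.getD_eq_getElem _ _ hn]
    exact h _ (List.getElem_mem hn)
  · exact Or.inl (List.getD_eq_default _ _ hn)

lemma prePer_mem {p w : List ℕ} (hp : ∀ d ∈ p, d = 1 ∨ d = 2) (hw : ∀ d ∈ w, d = 1 ∨ d = 2)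
    (n : ℕ) : prePer p w n = 1 ∨ prePer p w n = 2 := by
  unfold prePer catSeq perSeq
  split_ifs
  · exact getD_one_mem hp _
  · exact getD_one_mem hw _

lemma prePer_add_length {p w : List ℕ} {n : ℕ} (hn : p.length ≤ n) :
    prePer p w (n + w.length) = prePer p w n := by
  unfold prePer catSeq perSeq
  rw [if_neg (by omega), if_neg (by omega), show n + w.length - p.length =
    n - p.length + w.length by omega, Nat.add_mod_right]

lemma gapLeft_mem (n : ℕ) : gapLeft n = 1 ∨ gapLeft n = 2 :=
  prePer_mem (by decide) (by decide) n

lemma gapRight_mem (n : ℕ) : gapRight n = 1 ∨ gapRight n = 2 :=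
  prePer_mem (by decide) (by decide) n

lemma CInf_eq : CInf = 2 + cf0 gapRight + cf0 gapLeft := by
  rw [CInf, cfVal_eq]
  · have : ∀ p w, (fun i => prePer (2 :: p) w (i + 1)) = prePer p w := by
      intro p w
      ext i
      simp [prePer, catSeq]
    rw [this]
    rfl
  · intro n
    have := prePer_mem (p := [2,1,2,2,1,1,2,2,2,2,1,2,2,1,1,2,2,2,2,1,2,2,1,1,2,2,1,2,2,2,2,1,1])
      (w := [2,2,2,1,1,1]) (by decide) (by decide) (n + 1)
    omega

lemma noEarlyDescent_gapRight : noEarlyDescent gapRight (2 :: bigLeft) 16 = true := by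
  decide +kernel

lemma noLateDescent_gapRight : noLateDescent gapRight = true := by
  decide +kernel

lemma noEarlyDescent_gapLeft : noEarlyDescent gapLeft (2 :: bigRight) 15 = true := by
  decide +kernel

lemma noLateDescent_gapLeft : noLateDescent gapLeft = true := by
  decide +kernel

/-- `CInf` is almost a lower bound of `lam` at occurrences of `bigWord13`. -/
lemma CInf_sub_le_lam {A : ℤ → ℕ} (hA : ∀ n, 0 < A n) {i : ℤ} {m : ℕ}
    (hr : Reads A i bigLeft (2 :: bigRight)) (hgood : GoodOn A (i - m - 100) (i + m + 100)) :
    CInf - 4 * (1 / 2) ^ m ≤ lam A i := by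
  have hAi : A i = 2 := by simpa using (isPrefixOf_cons.1 hr.2).1
  have hr1 := reads_cons_right.1 hr
  have hR := cf0_sub_le_of_noDescent hA (j := i + 1) (L := 2 :: bigLeft) (m := m) gapRight_mem
    (fun n hn => prePer_add_length (by simp; omega)) noEarlyDescent_gapRight
    noLateDescent_gapRight ⟨hr1.1, isPrefixOf_nil _⟩
    (fun n hn => hr1.2 n _ ((by decide : ∀ n < 16, bigRight[n]? = some (gapRight n)) n hn))
    (hgood.mono (by simp [bigLeft]; omega) (by omega))
  have hrl := hr.reflect
  have hL := cf0_sub_le_of_noDescent (A := fun n => A (-n)) (fun _ => hA _) (j := 1 - i)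
    (L := 2 :: bigRight) (m := m) gapLeft_mem
    (fun n hn => prePer_add_length (by simp; omega)) noEarlyDescent_gapLeft
    noLateDescent_gapLeft ⟨hrl.1, isPrefixOf_nil _⟩
    (fun n hn => hrl.2 n _ ((by decide : ∀ n < 15, bigLeft[n]? = some (gapLeft n)) n hn))
    ((hgood.reflect hA).mono (by simp [bigRight]; omega) (by omega))
  have he : (fun k : ℕ => A (-(1 - i + k))) = fun k : ℕ => A (i - 1 - k) := by
    ext k
    congr 1
    ring
  rw [he] at hL
  rw [lam_eq hA, hAi, CInf_eq]
  push_cast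
  linarith

/-- The word `spWord` is centred at its digit in position `i`. -/
def SpAt (A : ℤ → ℕ) (i : ℤ) : Prop := Reads A i [2,2,2,1,1,2] [2,1,2,2,1,1,2,2,2]

/-- The reversal of `spWord` is centred at its digit in position `i`. -/
def RevSpAt (A : ℤ → ℕ) (i : ℤ) : Prop := Reads A i [1,2,2,1,1,2,2,2] [2,2,2,2,1,1,2]

lemma RevSpAt.reflect {A : ℤ → ℕ} {i : ℤ} (h : RevSpAt A i) : SpAt (fun n => A (-n)) (-i) := by
  have := (reads_cons_right.1 h).reflect
  rwa [show 1 - (i + 1) = -i by ring] at this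

lemma SpAt.reflect {A : ℤ → ℕ} {i : ℤ} (h : SpAt A i) : RevSpAt (fun n => A (-n)) (-i) := by
  have := (reads_cons_right.1 h).reflect
  rwa [show 1 - (i + 1) = -i by ring] at this

/-- The central digit is small or is the centre of `spWord` or of its reversal. -/
def centerFound (L R : List ℕ) : Bool :=
  match R with
  | [] => false
  | d :: R => isSmall L d R ||
      ([2,2,2,1,1,2].isPrefixOf L && [2,1,2,2,1,1,2,2,2].isPrefixOf (d :: R)) ||
      ([1,2,2,1,1,2,2,2].isPrefixOf L && [2,2,2,2,1,1,2].isPrefixOf (d :: R))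

/-- `spWord` also occurs nine digits earlier, or the central digit is that of `bigWord13`. -/
def shiftFound (L R : List ℕ) : Bool :=
  [2,2,2,1,1,2,2,1,2,2,2,2,1,1,2].isPrefixOf L ||
    (bigLeft.isPrefixOf L && (2 :: bigRight).isPrefixOf R)

lemma search_centerFound : search centerFound 40 [] [] = true := by decide +kernel

lemma search_shiftFound :
    search shiftFound 40 [2,2,2,1,1,2] [2,1,2,2,1,1,2,2,2] = true := by decide +kernel

lemma spAt_or_revSpAt {A : ℤ → ℕ} (hA : ∀ n, 0 < A n) {i : ℤ} (hgood : GoodOn A (i - 40) (i + 40))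
    (h : 3.118120178 < lam A i) : SpAt A i ∨ RevSpAt A i := by
  obtain ⟨L, R, hs, hr⟩ := exists_halt_of_search hA (j := i) search_centerFound
    ⟨isPrefixOf_nil _, isPrefixOf_nil _⟩ (by simpa using hgood)
  rcases R with _ | ⟨d, R⟩
  · cases hs
  simp only [centerFound, Bool.or_eq_true, Bool.and_eq_true] at hs
  rcases hs with (hs | hs) | hs
  · obtain rfl : A i = d := by simpa using (isPrefixOf_cons.1 hr.2).1
    exact absurd (lam_le_of_isSmall hA hr.1 (reads_cons_right.1 hr).2 hs) (not_le.2 h)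
  · exact Or.inl ⟨hr.1.mono hs.1, hr.2.mono hs.2⟩
  · exact Or.inr ⟨hr.1.mono hs.1, hr.2.mono hs.2⟩

lemma SpAt.sub_nine {A : ℤ → ℕ} (hA : ∀ n, 0 < A n) {i : ℤ} {m : ℕ} (h : SpAt A i)
    (hgood : GoodOn A (i - m - 100) (i + m + 100)) (hlam : lam A i < CInf - 4 * (1 / 2) ^ m) :
    SpAt A (i - 9) := by
  obtain ⟨L, R, hs, hr⟩ := exists_halt_of_search hA search_shiftFound h
    (hgood.mono (by simp; omega) (by simp; omega))
  simp only [shiftFound, Bool.or_eq_true, Bool.and_eq_true] at hs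
  rcases hs with hs | hs
  · have h1 : Reads A (i - 9 + 1 + 1 + 1 + 1 + 1 + 1 + 1 + 1 + 1)
        [2,2,2,1,1,2,2,1,2,2,2,2,1,1,2] [] := by
      rw [show i - 9 + 1 + 1 + 1 + 1 + 1 + 1 + 1 + 1 + 1 = i by ring]
      exact ⟨hr.1.mono hs, isPrefixOf_nil _⟩
    have h2 : Reads A (i - 9) [2,2,2,1,1,2] [2,1,2,2,1,1,2,2,2] := by
      simpa only [← reads_cons_right] using h1
    exact h2
  · exact absurd (CInf_sub_le_lam hA ⟨hr.1.mono hs.1, hr.2.mono hs.2⟩ hgood)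
      (not_le.2 hlam)

lemma RevSpAt.add_nine {A : ℤ → ℕ} (hA : ∀ n, 0 < A n) {i : ℤ} {m : ℕ} (h : RevSpAt A i)
    (hgood : GoodOn A (i - m - 100) (i + m + 100)) (hlam : lam A i < CInf - 4 * (1 / 2) ^ m) :
    RevSpAt A (i + 9) := by
  have := (h.reflect.sub_nine (fun _ => hA _) (m := m)
    ((hgood.reflect hA).mono (by omega) (by omega))
    (by rw [lam_reflect hA]; simpa using hlam)).reflect
  simpa [add_comm] using this

/-- The periodic sequence with Lagrange value `cInf`. -/
abbrev gapPer : ℤ → ℕ := perZ [2,2,2,2,1,1,2,2,1]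

lemma gapPer_pos (n : ℤ) : 0 < gapPer n := by
  have := getD_one_mem (l := [2,2,2,2,1,1,2,2,1]) (by decide) (n % 9).toNat
  simp only [gapPer, perZ, List.length_cons, List.length_nil]
  norm_num at this ⊢
  omega

lemma gapPer_add_nine (n : ℤ) : gapPer (n + 9) = gapPer n := by
  simp [gapPer, perZ]

lemma SpAt.eq_gapPer {A : ℤ → ℕ} {i k : ℤ} (h : SpAt A i) (h1 : -6 ≤ k) (h2 : k ≤ 8) :
    A (i + k) = gapPer (-k) := by
  rcases lt_or_ge k 0 with hk | hk
  · obtain ⟨n, rfl⟩ : ∃ n : ℕ, k = -1 - n := ⟨(-1 - k).toNat, by omega⟩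
    rw [show i + (-1 - n) = i - 1 - (n : ℤ) by ring]
    exact h.1 n _ ((by decide +kernel :
      ∀ n : ℕ, n < 6 → [2,2,2,1,1,2][n]? = some (gapPer (-(-1 - (n : ℤ))))) n (by omega))
  · lift k to ℕ using hk
    exact h.2 k _ ((by decide +kernel :
      ∀ n : ℕ, n < 9 → [2,1,2,2,1,1,2,2,2][n]? = some (gapPer (-(n : ℤ)))) k (by omega))

lemma RevSpAt.eq_gapPer {A : ℤ → ℕ} {i k : ℤ} (h : RevSpAt A i) (h1 : -8 ≤ k) (h2 : k ≤ 6) :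
    A (i + k) = gapPer k := by
  have := h.reflect.eq_gapPer (k := -k) (by omega) (by omega)
  rwa [← neg_add, neg_neg, neg_neg] at this

lemma eq_of_period {f g : ℤ → ℕ} {p : ℕ} {a b : ℤ} (hp : 0 < p)
    (hf : ∀ k, a ≤ k → f (k + p) = f k) (hg : ∀ k, g (k + p) = g k) (hab : a ≤ b)
    (h : ∀ k, b ≤ k → k < b + p → f k = g k) {k : ℤ} (hk : a ≤ k) : f k = g k := by
  have hfq : ∀ (q : ℕ) (k : ℤ), a ≤ k → f (k + p * q) = f k := by
    intro q k hk
    induction q with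
    | zero => simp
    | succ q ih =>
      have hk' := hk.trans (le_add_of_nonneg_right (by positivity : (0 : ℤ) ≤ p * q))
      rw [Nat.cast_succ, mul_add, mul_one, ← add_assoc, hf _ hk', ih]
  have hgq : ∀ (q : ℕ) (k : ℤ), g (k + p * q) = g k := by
    intro q k
    induction q with
    | zero => simp
    | succ q ih => rw [Nat.cast_succ, mul_add, mul_one, ← add_assoc, hg, ih]
  have hp' : (0 : ℤ) < p := by exact_mod_cast hp
  have h0 := Int.emod_nonneg (k - b) hp'.ne'
  have h1 := Int.emod_lt_of_pos (k - b) hp'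
  have h2 := Int.emod_add_mul_ediv (k - b) p
  have h3 := h (b + (k - b) % p) (by omega) (by omega)
  obtain ⟨q, hq | hq⟩ := ((k - b) / p).eq_nat_or_neg
  · rw [hq] at h2
    rw [show k = b + (k - b) % p + p * q by omega, hfq _ _ (by omega), hgq, h3]
  · rw [hq, mul_neg] at h2
    rw [← hfq q k hk, ← hgq q k, show k + p * q = b + (k - b) % p by omega, h3]

lemma perZ_natCast (w : List ℕ) (n : ℕ) : perZ w n = perSeq w n := by
  rw [perZ, perSeq, ← Int.natCast_mod, Int.toNat_natCast]

lemma lam_gapPer_zero : lam gapPer 0 = cInf := by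
  rw [lam_eq gapPer_pos, cInf, cfVal_eq]
  · have h1 : (fun k : ℕ => gapPer (0 + 1 + k)) =
        fun k => perSeq [2,2,2,2,1,1,2,2,1] (k + 1) := by
      ext k
      rw [← perZ_natCast]
      congr 1
      push_cast
      ring
    have h2 : (fun k : ℕ => gapPer (0 - 1 - k)) = perSeq [1,2,2,1,1,2,2,2,2] := by
      ext k
      have hk : ∀ r < 9, [2,2,2,2,1,1,2,2,1].getD (8 - r) 1 = [1,2,2,1,1,2,2,2,2].getD r 1 := by
        decide
      have hm : ((0 - 1 - (k : ℤ)) % 9).toNat = 8 - k % 9 := by omega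
      simpa only [gapPer, perZ, perSeq, List.length_cons, List.length_nil, Nat.cast_ofNat,
        zero_add, Nat.reduceAdd, hm] using hk (k % 9) (Nat.mod_lt _ (by norm_num))
    rw [h1, h2]
    rfl
  · intro n
    rw [← perZ_natCast]
    exact gapPer_pos _

/-- Far out in a sequence of eventual period nine, `cInf` is the only large value of `lam`. -/
lemma abs_lam_sub_cInf_le {A : ℤ → ℕ} (hA : ∀ n, 0 < A n) {M i : ℤ} {m : ℕ}
    (hper : ∀ n, M ≤ n → A (n + 9) = A n) (hi : M + m + 8 ≤ i) (h : SpAt A i ∨ RevSpAt A i) :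
    |lam A i - cInf| ≤ 4 * (1 / 2) ^ m := by
  have hf : ∀ k : ℤ, -(m + 8) ≤ k → A (i + (k + (9 : ℕ))) = A (i + k) := fun k hk => by
    rw [← add_assoc]
    exact hper _ (by omega)
  rcases h with h | h
  · have hpos : ∀ n, 0 < (fun n => gapPer (-n)) n := fun n => gapPer_pos _
    have := abs_lam_sub_le hA hpos (i := i) (j := -0) (m := m) fun k hk => by
      rw [abs_le] at hk
      have := eq_of_period (f := fun k => A (i + k)) (g := fun k => gapPer (-k)) (b := -6)
        (a := -(m + 6)) (p := 9) (by norm_num) (fun k hk => hf k (by omega))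
        (fun k => by rw [← gapPer_add_nine]; congr 1; push_cast; ring) (by omega)
        (fun k h1 h2 => h.eq_gapPer h1 (by push_cast at h2; omega)) (k := k) (by omega)
      simpa using this
    rwa [lam_reflect gapPer_pos, neg_neg, lam_gapPer_zero] at this
  · have := abs_lam_sub_le hA gapPer_pos (i := i) (j := 0) (m := m) fun k hk => by
      rw [abs_le] at hk
      have := eq_of_period (f := fun k => A (i + k)) (g := gapPer) (b := -8)
        (a := -(m + 8)) (p := 9) (by norm_num) hf
        (fun k => gapPer_add_nine k) (by omega)
        (fun k h1 h2 => h.eq_gapPer h1 (by push_cast at h2; omega)) (k := k) (by omega)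
      simpa using this
    rwa [lam_gapPer_zero] at this

lemma period_nine_of_spAt {A : ℤ → ℕ} {M : ℤ} (hstep : ∀ i, M ≤ i → SpAt A i → SpAt A (i - 9))
    (hfreq : ∀ N, ∃ i, N ≤ i ∧ SpAt A i) {n : ℤ} (hn : M ≤ n) : A (n + 9) = A n := by
  obtain ⟨i, hi, h⟩ := hfreq (n + 9)
  have hall : ∀ t : ℕ, n + 1 ≤ i - 9 * t + 9 → SpAt A (i - 9 * t) := by
    intro t
    induction t with
    | zero => simp [h]
    | succ t ih =>
      intro ht
      push_cast at ht ⊢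
      have := hstep _ (by omega) (ih (by omega))
      rwa [show i - 9 * ((t : ℤ) + 1) = i - 9 * t - 9 by ring]
  obtain ⟨t, ht⟩ : ∃ t : ℕ, (t : ℤ) = (i - (n + 1)) / 9 := ⟨((i - (n + 1)) / 9).toNat, by omega⟩
  have hs := hall t (by omega)
  have hs' := hall (t + 1) (by push_cast; omega)
  have e1 := hs.eq_gapPer (k := n + 9 - (i - 9 * t)) (by omega) (by omega)
  have e2 := hs'.eq_gapPer (k := n - (i - 9 * (t + 1 : ℕ))) (by push_cast; omega)
    (by push_cast; omega)
  rw [add_sub_cancel] at e1 e2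
  rw [e1, e2]
  congr 1
  push_cast
  ring

lemma period_nine_of_revSpAt {A : ℤ → ℕ} {i : ℤ} (h : RevSpAt A i)
    (hstep : ∀ j, i ≤ j → RevSpAt A j → RevSpAt A (j + 9)) {n : ℤ} (hn : i ≤ n) :
    A (n + 9) = A n := by
  have hall : ∀ t : ℕ, RevSpAt A (i + 9 * t) := by
    intro t
    induction t with
    | zero => simpa using h
    | succ t ih =>
      have := hstep _ (by omega) ih
      rwa [show i + 9 * ((t + 1 : ℕ) : ℤ) = i + 9 * t + 9 by push_cast; ring]
  obtain ⟨t, ht⟩ : ∃ t : ℕ, (t : ℤ) = (n - i + 8) / 9 := ⟨((n - i + 8) / 9).toNat, by omega⟩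
  have e1 := (hall (t + 1)).eq_gapPer (k := n + 9 - (i + 9 * (t + 1 : ℕ))) (by push_cast; omega)
    (by push_cast; omega)
  have e2 := (hall t).eq_gapPer (k := n - (i + 9 * t)) (by omega) (by omega)
  rw [add_sub_cancel] at e1 e2
  rw [e1, e2]
  congr 1
  push_cast
  ring

lemma le_lam {A : ℤ → ℕ} (hA : ∀ n, 0 < A n) (i : ℤ) : (A i : ℝ) ≤ lam A i := by
  have h1 := (cf0_mem_Icc (g := fun k : ℕ => A (i + 1 + k)) (fun _ => hA _)).1
  have h2 := (cf0_mem_Icc (g := fun k : ℕ => A (i - 1 - k)) (fun _ => hA _)).1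
  rw [lam_eq hA]
  linarith

lemma exists_goodOn {A : ℤ → ℕ} (hA : ∀ n, 0 < A n) (h : ∀ᶠ i in atTop, lam A i < 3.1181201784) :
    ∃ M, ∀ b, GoodOn A M b := by
  obtain ⟨M, hM⟩ := eventually_atTop.1 h
  refine ⟨M, fun b i hi _ => ⟨?_, hM i hi⟩⟩
  have hle : ∀ j, M ≤ j → A j ≤ 3 := by
    intro j hj
    have h1 : (A j : ℝ) < (4 : ℕ) := by
      have h1 := le_lam hA j
      have h2 := hM j hj
      norm_num at h2
      push_cast
      linarith
    have := Nat.cast_lt.1 h1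
    omega
  have h3 : A i ≠ 3 := by
    intro h3
    have hlt := hM i hi
    have h1 := (cf0_mem_Icc (g := fun k : ℕ => A (i - 1 - k)) (fun _ => hA _)).1
    rw [lam_eq hA, h3, cf0_eq (fun _ => hA _)] at hlt
    have h2 := cf0_mem_Icc (g := fun k : ℕ => A (i + 1 + (k + 1 : ℕ))) (fun _ => hA _)
    have h4 : (A (i + 1 + (0 : ℕ)) : ℝ) ≤ 3 := by exact_mod_cast hle _ (by omega)
    have h5 : (0 : ℝ) < A (i + 1 + (0 : ℕ)) := by exact_mod_cast hA _
    have h6 : (1 : ℝ) / 4 ≤ 1 / (A (i + 1 + (0 : ℕ)) + cf0 (fun k => A (i + 1 + (k + 1 : ℕ)))) :=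
      one_div_le_one_div_of_le (by linarith [h2.1]) (by linarith [h2.2])
    norm_num at hlt h6
    linarith
  have := hle i hi
  have := hA i
  omega

/-- The word formed by the `n` terms of `g` starting from the index `0`. -/
def word (g : ℕ → ℕ) (n : ℕ) : List ℕ := (List.range n).map g

lemma isPrefixOf_word (g : ℕ → ℕ) (n : ℕ) : IsPrefixOf (word g n) g := by
  intro k d h
  obtain ⟨hk, rfl⟩ := List.getElem?_eq_some_iff.1 h
  simp [word]

/-- The bounds of `lamBound` using the `r` digits of `A` on either side of position `i`. -/
def windowBound (b : Bool) (r : ℕ) (A : ℤ → ℕ) (i : ℤ) : ℕ × ℕ :=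
  lamBound b (word (fun k => A (i - 1 - k)) r) (A i) (word (fun k => A (i + 1 + k)) r)

lemma lam_le_of_windowBound {A : ℤ → ℕ} (hA : ∀ n, 0 < A n) {i : ℤ} {r p q : ℕ} (hq : 0 < q)
    (h : Nat.ble (q * (windowBound true r A i).1) (p * (windowBound true r A i).2) = true) :
    lam A i ≤ p / q := by
  obtain ⟨hpos, hle⟩ := lamBound_spec hA (i := i) (isPrefixOf_word _ r) (isPrefixOf_word _ r) true
  have h' : (q * (windowBound true r A i).1 : ℝ) ≤ p * (windowBound true r A i).2 := by
    exact_mod_cast Nat.le_of_ble_eq_true h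
  rw [cond_true] at hle
  rw [le_div_iff₀ (by exact_mod_cast hq)]
  refine le_of_mul_le_mul_right ?_ (Nat.cast_pos.2 hpos : (0 : ℝ) < _)
  rw [windowBound] at h'
  nlinarith [(Nat.cast_pos.2 hq : (0 : ℝ) < _)]

lemma le_lam_of_windowBound {A : ℤ → ℕ} (hA : ∀ n, 0 < A n) {i : ℤ} {r p q : ℕ} (hq : 0 < q)
    (h : Nat.ble (p * (windowBound false r A i).2) (q * (windowBound false r A i).1) = true) :
    (p / q : ℝ) ≤ lam A i := by
  obtain ⟨hpos, hle⟩ := lamBound_spec hA (i := i) (isPrefixOf_word _ r) (isPrefixOf_word _ r) false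
  have h' : (p * (windowBound false r A i).2 : ℝ) ≤ q * (windowBound false r A i).1 := by
    exact_mod_cast Nat.le_of_ble_eq_true h
  rw [cond_false] at hle
  rw [div_le_iff₀ (by exact_mod_cast hq)]
  refine le_of_mul_le_mul_right ?_ (Nat.cast_pos.2 hpos : (0 : ℝ) < _)
  rw [windowBound] at h'
  nlinarith [(Nat.cast_pos.2 hq : (0 : ℝ) < _)]

/-- The period of the ends of the bi-infinite sequence `gapBi`. -/
def gapEnds : List ℕ := [2,2,2,1,1,1]

/-- The middle part of the bi-infinite sequence `gapBi`. -/
def gapCore : List ℕ :=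
  [1,2,2,2,2,1,2,2,1,1,2,2,2,2,1,2,2,1,1,2,2,2,2,1,2,2,1,1,2,2,2,2,1,2,2,1,1,2,2,1,2,2,2,2,1,1]

/-- The bi-infinite sequence whose value of `lam` at position `13` is `CInf`. -/
def gapBi (n : ℤ) : ℕ :=
  if 0 ≤ n ∧ n < 46 then gapCore.getD n.toNat 1
  else if n < 0 then perZ gapEnds n else perZ gapEnds (n - 46)

lemma gapBi_pos (n : ℤ) : 0 < gapBi n := by
  have h1 : ∀ k, 0 < gapCore.getD k 1 := fun k => by
    have := getD_one_mem (l := gapCore) (by decide) k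
    omega
  have h2 : ∀ k, 0 < gapEnds.getD k 1 := fun k => by
    have := getD_one_mem (l := gapEnds) (by decide) k
    omega
  unfold gapBi perZ
  split_ifs
  · exact h1 _
  · exact h2 _
  · exact h2 _

lemma perZ_add_mul_length (w : List ℕ) (n q : ℤ) : perZ w (n + w.length * q) = perZ w n := by
  simp [perZ]

lemma gapBi_add_of_neg {n q : ℤ} (h : n < 0) (h' : n + 6 * q < 0) :
    gapBi (n + 6 * q) = gapBi n := by
  unfold gapBi
  rw [if_neg (by omega), if_pos h', if_neg (by omega), if_pos h]
  exact perZ_add_mul_length gapEnds n q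

lemma gapBi_add_of_le {n q : ℤ} (h : 46 ≤ n) (h' : 46 ≤ n + 6 * q) :
    gapBi (n + 6 * q) = gapBi n := by
  unfold gapBi
  rw [if_neg (by omega), if_neg (by omega), if_neg (by omega), if_neg (by omega),
    show n + 6 * q - 46 = n - 46 + 6 * q by ring]
  exact perZ_add_mul_length gapEnds _ q

lemma gapBi_add_core {n : ℤ} {q : ℤ} (h : n < 0) (h' : 46 ≤ n + 46 + 6 * q) :
    gapBi (n + 46 + 6 * q) = gapBi n := by
  unfold gapBi
  rw [if_neg (by omega), if_neg (by omega), if_neg (by omega), if_pos h,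
    show n + 46 + 6 * q - 46 = n + 6 * q by ring]
  exact perZ_add_mul_length gapEnds _ q

lemma lam_gapBi_thirteen : lam gapBi 13 = CInf := by
  have hR : (fun k : ℕ => gapBi (13 + 1 + k)) = gapRight := by
    ext k
    rcases lt_or_ge k 32 with hk | hk
    · exact (by decide +kernel : ∀ k : ℕ, k < 32 → gapBi (13 + 1 + k) = gapRight k) k hk
    · obtain ⟨r, q, hr, rfl⟩ : ∃ r q, r < 6 ∧ k = 32 + r + 6 * q :=
        ⟨(k - 32) % 6, (k - 32) / 6, Nat.mod_lt _ (by norm_num), by omega⟩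
      have h38 : gapRight (32 + r + 6 * q) = gapRight (32 + r) := by
        induction q with
        | zero => rfl
        | succ q ih =>
          rw [show 32 + r + 6 * (q + 1) = 32 + r + 6 * q + 6 by ring]
          exact (prePer_add_length (by simp; omega)).trans (ih (by omega))
      rw [h38, show (13 + 1 + ((32 + r + 6 * q : ℕ) : ℤ)) = (46 + r) + 6 * (q : ℤ) by
        push_cast; ring, gapBi_add_of_le (by omega) (by omega)]
      exact (by decide +kernel : ∀ r : ℕ, r < 6 → gapBi (46 + r) = gapRight (32 + r)) r hr
  have hL : (fun k : ℕ => gapBi (13 - 1 - k)) = gapLeft := by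
    ext k
    rcases lt_or_ge k 13 with hk | hk
    · exact (by decide +kernel : ∀ k : ℕ, k < 13 → gapBi (13 - 1 - k) = gapLeft k) k hk
    · obtain ⟨r, q, hr, rfl⟩ : ∃ r q, r < 6 ∧ k = 13 + r + 6 * q :=
        ⟨(k - 13) % 6, (k - 13) / 6, Nat.mod_lt _ (by norm_num), by omega⟩
      have h38 : gapLeft (13 + r + 6 * q) = gapLeft (13 + r) := by
        induction q with
        | zero => rfl
        | succ q ih =>
          rw [show 13 + r + 6 * (q + 1) = 13 + r + 6 * q + 6 by ring]
          exact (prePer_add_length (by simp; omega)).trans (ih (by omega))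
      rw [h38, show (13 - 1 - ((13 + r + 6 * q : ℕ) : ℤ)) = (-1 - r) + 6 * (-q : ℤ) by
        push_cast; ring, gapBi_add_of_neg (by omega) (by omega)]
      exact (by decide +kernel : ∀ r : ℕ, r < 6 → gapBi (-1 - r) = gapLeft (13 + r)) r hr
  rw [lam_eq gapBi_pos, hR, hL, CInf_eq]
  have : gapBi 13 = 2 := by decide +kernel
  rw [this]
  norm_num

lemma cInf_ge : (3.118120178 : ℝ) ≤ cInf := by
  rw [← lam_gapPer_zero]
  have := le_lam_of_windowBound gapPer_pos (i := 0) (r := 30) (p := 3118120178)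
    (q := 1000000000) (by norm_num) (by decide +kernel)
  norm_num at this ⊢
  exact this

lemma cInf_le : cInf ≤ 3.11812017815 := by
  rw [← lam_gapPer_zero]
  have := lam_le_of_windowBound gapPer_pos (i := 0) (r := 30) (p := 311812017815)
    (q := 100000000000) (by norm_num) (by decide +kernel)
  norm_num at this ⊢
  exact this

lemma CInf_ge : (3.1181201782 : ℝ) ≤ CInf := by
  rw [← lam_gapBi_thirteen]
  have := le_lam_of_windowBound gapBi_pos (i := 13) (r := 30) (p := 31181201782)
    (q := 10000000000) (by norm_num) (by decide +kernel)
  norm_num at this ⊢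
  exact this

lemma CInf_le : CInf ≤ 3.11812017835 := by
  rw [← lam_gapBi_thirteen]
  have := lam_le_of_windowBound gapBi_pos (i := 13) (r := 30) (p := 311812017835)
    (q := 100000000000) (by norm_num) (by decide +kernel)
  norm_num at this ⊢
  exact this

lemma windowBound_congr {A B : ℤ → ℕ} {i j : ℤ} {r : ℕ}
    (h : ∀ k : ℤ, |k| ≤ r → A (i + k) = B (j + k)) (b : Bool) :
    windowBound b r A i = windowBound b r B j := by
  have h0 : A i = B j := by simpa using h 0 (by simp)
  have h1 : word (fun k => A (i - 1 - k)) r = word (fun k => B (j - 1 - k)) r := by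
    refine List.map_congr_left fun k hk => ?_
    have hk := List.mem_range.1 hk
    have := h (-1 - k) (by rw [abs_le]; omega)
    convert this using 2 <;> ring
  have h2 : word (fun k => A (i + 1 + k)) r = word (fun k => B (j + 1 + k)) r := by
    refine List.map_congr_left fun k hk => ?_
    have hk := List.mem_range.1 hk
    have := h (1 + k) (by rw [abs_le]; omega)
    convert this using 2 <;> ring
  rw [windowBound, windowBound, h0, h1, h2]

lemma windowBound_gapBi : ∀ n : ℕ, n < 118 → n ≠ 49 →
    Nat.ble (10000000000 * (windowBound true 30 gapBi (n - 36)).1)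
      (31181201782 * (windowBound true 30 gapBi (n - 36)).2) = true := by
  decide +kernel

lemma lam_gapBi_le (j : ℤ) : lam gapBi j ≤ CInf := by
  rcases eq_or_ne j 13 with rfl | hj
  · exact lam_gapBi_thirteen.le
  obtain ⟨n, hn, hn', hw⟩ : ∃ n : ℕ, n < 118 ∧ n ≠ 49 ∧
      windowBound true 30 gapBi j = windowBound true 30 gapBi (n - 36) := by
    rcases lt_or_ge j (-36) with h | h
    · refine ⟨(j % 6).toNat, by omega, by omega, windowBound_congr (fun k hk => ?_) _⟩
      rw [abs_le] at hk
      rw [show j + k = ((j % 6).toNat : ℤ) - 36 + k + 6 * (j / 6 + 6) by omega,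
        gapBi_add_of_neg (by omega) (by omega)]
    rcases lt_or_ge j 82 with h2 | h2
    · exact ⟨(j + 36).toNat, by omega, by omega, by congr 1; omega⟩
    · refine ⟨112 + ((j + 36 - 112) % 6).toNat, by omega, by omega,
        windowBound_congr (fun k hk => ?_) _⟩
      rw [abs_le] at hk
      rw [show j + k = ((112 + ((j + 36 - 112) % 6).toNat : ℕ) : ℤ) - 36 + k +
        6 * ((j + 36 - 112) / 6) by push_cast; omega, gapBi_add_of_le (by omega) (by omega)]
  have := lam_le_of_windowBound gapBi_pos (i := j) (r := 30) (p := 31181201782)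
    (q := 10000000000) (by norm_num) (by rw [hw]; exact windowBound_gapBi n hn hn')
  refine le_trans ?_ CInf_ge
  norm_num at this ⊢
  exact this

lemma windowBound_gapPer : ∀ n : ℕ, n < 9 → n ≠ 0 →
    Nat.ble (10 * (windowBound true 30 gapPer n).1) (31 * (windowBound true 30 gapPer n).2) =
      true := by
  decide +kernel

lemma lam_gapPer_nine_mul (q : ℤ) : lam gapPer (9 * q) = cInf := by
  have h : ∀ k, gapPer (k + 9 * q) = gapPer k := fun k =>
    perZ_add_mul_length [2,2,2,2,1,1,2,2,1] k q
  rw [← lam_gapPer_zero, lam_eq gapPer_pos, lam_eq gapPer_pos]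
  simp only [← h 0, ← h (0 + 1 + _), ← h (0 - 1 - _)]
  ring_nf

lemma lam_gapPer_le (j : ℤ) : lam gapPer j ≤ cInf := by
  rcases eq_or_ne (j % 9).toNat 0 with hj | hj
  · rw [show j = 9 * (j / 9) by omega, lam_gapPer_nine_mul]
  · have hper : ∀ k : ℤ, |k| ≤ (30 : ℕ) → gapPer (j + k) = gapPer (((j % 9).toNat : ℕ) + k) := by
      intro k _
      rw [show j + k = ((j % 9).toNat : ℕ) + k + 9 * (j / 9) by omega]
      exact perZ_add_mul_length [2,2,2,2,1,1,2,2,1] _ _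
    have := lam_le_of_windowBound gapPer_pos (i := j) (r := 30) (p := 31) (q := 10) (by norm_num)
      (by rw [windowBound_congr hper]; exact windowBound_gapPer _ (by omega) hj)
    refine le_trans ?_ cInf_ge
    norm_num at this ⊢
    linarith

lemma lagrangeVal_eq {A : ℤ → ℕ} {x : ℝ} (hle : ∀ ε > 0, ∀ᶠ i in atTop, lam A i ≤ x + ε)
    (hge : ∀ ε > 0, ∃ᶠ i in atTop, x - ε ≤ lam A i) :
    IsBoundedUnder (· ≤ ·) atTop (lam A) ∧ x = lagrangeVal A := by
  have hb : IsBoundedUnder (· ≤ ·) atTop (lam A) := ⟨x + 1, by simpa using hle 1 one_pos⟩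
  have hc : IsCoboundedUnder (· ≤ ·) atTop (lam A) :=
    IsCoboundedUnder.of_frequently_ge (hge 1 one_pos)
  refine ⟨hb, le_antisymm ?_ ?_⟩
  · refine le_of_forall_pos_sub_le fun ε hε => ?_
    exact le_limsup_of_frequently_le (hge ε hε) hb
  · refine le_of_forall_pos_le_add fun ε hε => ?_
    exact limsup_le_of_le hc (hle ε hε)

lemma lagrangeVal_gapPer :
    IsBoundedUnder (· ≤ ·) atTop (lam gapPer) ∧ cInf = lagrangeVal gapPer := by
  refine lagrangeVal_eq (fun ε hε => Eventually.of_forall fun j => ?_) fun ε hε => ?_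
  · linarith [lam_gapPer_le j]
  · refine frequently_atTop.2 fun N => ⟨9 * |N|, by linarith [le_abs_self N, abs_nonneg N], ?_⟩
    rw [lam_gapPer_nine_mul]
    linarith

/-- The position of the `k`-th block of the sequence `gapSeq`. -/
def blockStart (k : ℕ) : ℕ := k * (3 * k + 43)

lemma blockStart_succ (k : ℕ) : blockStart (k + 1) = blockStart k + (46 + 6 * k) := by
  unfold blockStart
  ring

lemma blockStart_strictMono : StrictMono blockStart :=
  strictMono_nat_of_lt_succ fun k => by rw [blockStart_succ]; omega

/-- The index of the block of `gapSeq` containing position `n`. -/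
def blockIndex (n : ℕ) : ℕ := Nat.findGreatest (fun k => blockStart k ≤ n) n

/-- A concatenation of ever longer central parts of `gapBi`. -/
def gapSeq (n : ℤ) : ℕ := gapBi ((n.toNat : ℤ) - blockStart (blockIndex n.toNat))

lemma blockIndex_eq {n k : ℕ} (h : blockStart k ≤ n) (h' : n < blockStart (k + 1)) :
    blockIndex n = k := by
  refine Nat.findGreatest_eq_iff.2 ⟨?_, fun _ => h, fun j hj _ => ?_⟩
  · exact (blockStart_strictMono.le_apply (x := k)).trans h
  · exact not_le.2 (h'.trans_le (blockStart_strictMono.monotone hj))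

lemma gapSeq_blockStart_add {k : ℕ} {j : ℤ} (h : 0 ≤ j) (h' : j < 46 + 6 * k) :
    gapSeq (blockStart k + j) = gapBi j := by
  lift j to ℕ using h
  have : ((blockStart k : ℤ) + j).toNat = blockStart k + j := by omega
  rw [gapSeq, this, blockIndex_eq (k := k) (by omega) (by rw [blockStart_succ]; omega)]
  congr 1
  push_cast
  ring

lemma gapSeq_blockStart_succ_add {k : ℕ} {j : ℤ} (h : -(6 * k) ≤ j) (h' : j < 46 + 6 * (k + 1)) :
    gapSeq (blockStart (k + 1) + j) = gapBi j := by
  rcases lt_or_ge j 0 with hj | hj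
  · rw [blockStart_succ, ← gapBi_add_core (q := k) hj (by omega),
      ← gapSeq_blockStart_add (k := k) (by omega) (by omega)]
    congr 1
    push_cast
    ring
  · exact gapSeq_blockStart_add hj (by push_cast; omega)

lemma exists_gapSeq_eq_gapBi (r : ℕ) {n : ℕ} (hn : blockStart (r + 1) ≤ n) :
    ∃ j : ℤ, ∀ t : ℤ, |t| ≤ r → gapSeq (n + t) = gapBi (j + t) := by
  have h0 : blockStart (blockIndex n) ≤ n :=
    Nat.findGreatest_spec (P := fun k => blockStart k ≤ n) (Nat.zero_le n) (by simp [blockStart])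
  have h1 : n < blockStart (blockIndex n + 1) := by
    by_contra! h
    have := Nat.le_findGreatest (P := fun k => blockStart k ≤ n)
      ((blockStart_strictMono.le_apply (x := blockIndex n + 1)).trans h) h
    exact absurd this (Nat.not_succ_le_self _)
  have h2 : r + 1 < blockIndex n + 1 := blockStart_strictMono.lt_iff_lt.1 (hn.trans_lt h1)
  obtain ⟨k, hk⟩ := Nat.exists_eq_succ_of_ne_zero (show blockIndex n ≠ 0 by omega)
  rw [hk, Nat.succ_eq_add_one] at h0 h1 h2
  have h3 := blockStart_succ (k + 1)
  rcases lt_or_ge (n + r) (blockStart (k + 1 + 1)) with h | h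
  · refine ⟨n - blockStart (k + 1), fun t ht => ?_⟩
    rw [abs_le] at ht
    rw [← gapSeq_blockStart_succ_add (k := k) (by omega) (by omega)]
    congr 1
    ring
  · refine ⟨n - blockStart (k + 1 + 1), fun t ht => ?_⟩
    rw [abs_le] at ht
    rw [← gapSeq_blockStart_succ_add (k := k + 1) (by push_cast; omega) (by push_cast; omega)]
    congr 1
    ring

lemma gapSeq_pos (n : ℤ) : 0 < gapSeq n := gapBi_pos _

lemma lagrangeVal_gapSeq :
    IsBoundedUnder (· ≤ ·) atTop (lam gapSeq) ∧ CInf = lagrangeVal gapSeq := by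
  have hm : ∀ ε > (0 : ℝ), ∃ m : ℕ, (1 / 2 : ℝ) ^ m < ε / 4 := fun ε hε =>
    exists_pow_lt_of_lt_one (by positivity) (by norm_num)
  refine lagrangeVal_eq (fun ε hε => ?_) fun ε hε => ?_
  · obtain ⟨m, hm⟩ := hm ε hε
    filter_upwards [eventually_ge_atTop (blockStart (m + 1) : ℤ)] with n hn
    lift n to ℕ using by omega
    obtain ⟨j, hj⟩ := exists_gapSeq_eq_gapBi m (Int.ofNat_le.1 hn)
    have := abs_lam_sub_le gapSeq_pos gapBi_pos hj
    linarith [(abs_le.1 this).2, lam_gapBi_le j]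
  · obtain ⟨m, hm⟩ := hm ε hε
    refine frequently_atTop.2 fun N => ⟨blockStart (N.toNat + m + 1) + 13, ?_, ?_⟩
    · have := blockStart_strictMono.le_apply (x := N.toNat + m + 1)
      omega
    have := abs_lam_sub_le gapSeq_pos gapBi_pos
      (i := blockStart (N.toNat + m + 1) + 13) (j := 13) (m := m) fun k hk => by
        rw [abs_le] at hk
        rw [add_assoc]
        exact gapSeq_blockStart_succ_add (by push_cast; omega) (by push_cast; omega)
    rw [lam_gapBi_thirteen] at this
    linarith [(abs_le.1 this).1]

lemma not_mem_Ioo_of_lagrangeVal {A : ℤ → ℕ} (hA : ∀ n, 0 < A n)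
    (hb : IsBoundedUnder (· ≤ ·) atTop (lam A)) : lagrangeVal A ∉ Ioo cInf CInf := by
  rintro ⟨h1, h2⟩
  have hc : IsCoboundedUnder (· ≤ ·) atTop (lam A) :=
    IsCoboundedUnder.of_frequently_ge (a := 0)
      (Eventually.of_forall fun i => (Nat.cast_nonneg _).trans (le_lam hA i)).frequently
  obtain ⟨c, hc1, hc2⟩ := exists_between h1
  obtain ⟨C, hC1, hC2⟩ := exists_between h2
  have hlt : ∀ᶠ i in atTop, lam A i < C := eventually_lt_of_limsup_lt hC1 hb
  have hgt : ∃ᶠ i in atTop, c < lam A i := frequently_lt_of_lt_limsup hc hc2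
  obtain ⟨m, hm⟩ := exists_pow_lt_of_lt_one
    (show 0 < min (c - cInf) (CInf - C) / 4 from
      div_pos (lt_min (sub_pos.2 hc1) (sub_pos.2 hC2)) (by norm_num))
    (by norm_num : (1 / 2 : ℝ) < 1)
  have hm1 := min_le_left (c - cInf) (CInf - C)
  have hm2 := min_le_right (c - cInf) (CInf - C)
  obtain ⟨M₁, hgood⟩ := exists_goodOn hA
    (hlt.mono fun i hi => hi.trans (by have := CInf_le; norm_num at this ⊢; linarith))
  obtain ⟨M₂, hM₂⟩ := eventually_atTop.1 hlt
  obtain ⟨M, hMle₁, hMle₂⟩ : ∃ M, M₁ + m + 100 ≤ M ∧ M₂ ≤ M :=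
    ⟨max (M₁ + m + 100) M₂, le_max_left _ _, le_max_right _ _⟩
  have hgood' : ∀ i, M ≤ i → GoodOn A (i - m - 100) (i + m + 100) := fun i hi =>
    (hgood _).mono (by omega) le_rfl
  have hlam : ∀ i, M ≤ i → lam A i < CInf - 4 * (1 / 2) ^ m := fun i hi =>
    (hM₂ i (by omega)).trans (by linarith)
  have hcentre : ∀ i, M ≤ i → c < lam A i → SpAt A i ∨ RevSpAt A i := fun i hi h =>
    spAt_or_revSpAt hA ((hgood' i hi).mono (by omega) (by omega))
      ((by have := cInf_ge; norm_num at this ⊢; linarith : (3.118120178 : ℝ) < c).trans h)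
  have hfreq : ∀ N, ∃ i, N ≤ i ∧ c < lam A i := fun N => frequently_atTop.1 hgt N
  obtain ⟨M', hM', hper⟩ : ∃ M', M ≤ M' ∧ ∀ n, M' ≤ n → A (n + 9) = A n := by
    by_cases hSp : ∀ N, ∃ i, N ≤ i ∧ SpAt A i
    · exact ⟨M, le_rfl, fun n hn => period_nine_of_spAt
        (fun i hi h => h.sub_nine hA (hgood' i hi) (hlam i hi)) hSp hn⟩
    · push Not at hSp
      obtain ⟨N, hN⟩ := hSp
      obtain ⟨i, hi, hci⟩ := hfreq (max M N)
      have hMi : M ≤ i := (le_max_left _ _).trans hi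
      have h := (hcentre i hMi hci).resolve_left (hN i ((le_max_right _ _).trans hi))
      exact ⟨i, hMi, fun n hn => period_nine_of_revSpAt h (fun j hj h =>
        h.add_nine hA (hgood' j (hMi.trans hj)) (hlam j (hMi.trans hj))) hn⟩
  obtain ⟨i, hi, hci⟩ := hfreq (M' + m + 8)
  have := abs_lam_sub_cInf_le hA (m := m) hper hi (hcentre i (by omega) hci)
  linarith [(abs_le.1 this).2]

lemma eq_of_Ioo_subset {S : Set ℝ} {a b c d : ℝ} (hcd : c < d) (hc : c ∈ S) (hd : d ∈ S)
    (hsub : Ioo c d ⊆ Ioo a b) (hab : Ioo a b ∩ S = ∅) : Ioo a b = Ioo c d := by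
  obtain ⟨h1, h2⟩ := (Ioo_subset_Ioo_iff hcd).1 hsub
  have hc' : ¬ a < c := fun h => (hab.subset ⟨⟨h, hcd.trans_le h2⟩, hc⟩ : c ∈ (∅ : Set ℝ))
  have hd' : ¬ d < b := fun h => (hab.subset ⟨⟨h1.trans_lt hcd, h⟩, hd⟩ : d ∈ (∅ : Set ℝ))
  rw [le_antisymm h1 (not_lt.1 hc'), le_antisymm h2 (not_lt.1 hd')]

lemma cInf_lt_CInf : cInf < CInf := by
  have h1 := cInf_le
  have h2 := CInf_ge
  norm_num at h1 h2
  linarith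

/-- `c_∞, C_∞ ∈ L` while `(c_∞, C_∞) ∩ L = ∅`; hence `(c_∞, C_∞)` is
a maximal open interval in the complement of `L`. -/
theorem maximal_gap :
    cInf = lagrangeVal (perZ [2,2,2,2,1,1,2,2,1]) ∧
    cInf ∈ LagrangeSpectrum ∧ CInf ∈ LagrangeSpectrum ∧
    LagrangeSpectrum ∩ Ioo cInf CInf = ∅ ∧
    ∀ a b : ℝ, Ioo cInf CInf ⊆ Ioo a b → Ioo a b ∩ LagrangeSpectrum = ∅ →
      Ioo a b = Ioo cInf CInf := by
  have hc : cInf ∈ LagrangeSpectrum :=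
    ⟨gapPer, gapPer_pos, lagrangeVal_gapPer.1, lagrangeVal_gapPer.2⟩
  have hC : CInf ∈ LagrangeSpectrum :=
    ⟨gapSeq, gapSeq_pos, lagrangeVal_gapSeq.1, lagrangeVal_gapSeq.2⟩
  refine ⟨lagrangeVal_gapPer.2, hc, hC, ?_, fun a b hsub hab =>
    eq_of_Ioo_subset cInf_lt_CInf hc hC hsub hab⟩
  rw [eq_empty_iff_forall_notMem]
  rintro x ⟨⟨A, hA, hb, rfl⟩, hx⟩
  exact not_mem_Ioo_of_lagrangeVal hA hb hx
end

section
/- Every sequence (g_n) in {1,2}^N that is an infinite concatenation of the blocks (1,1) and (2,2) contains no word of P as a consecutive subword. Consequently, the Gauss-Cantor set K({1_2, 2_2}) is contained in Y, and hence HD(Y) >= HD(K({1_2, 2_2})). -/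
open Filter Set

theorem isBlockSeq.eq_or_eq {g : ℕ → ℕ} (hg : isBlockSeq g) (k : ℕ) :
    g k = g (k + 1) ∨ g (k + 1) = g (k + 2) := by
  rcases Nat.even_or_odd' k with ⟨n, rfl | rfl⟩
  · have := hg n
    omega
  · have := hg (n + 1)
    rw [show 2 * (n + 1) = 2 * n + 1 + 1 by ring] at this
    exact .inr (by rw [show 2 * n + 1 + 2 = 2 * n + 1 + 1 + 1 by ring]; omega)

theorem isBlockSeq.eq_one_or_eq_two {g : ℕ → ℕ} (hg : isBlockSeq g) (k : ℕ) :
    g k = 1 ∨ g k = 2 := by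
  rcases Nat.even_or_odd' k with ⟨n, rfl | rfl⟩ <;>
  · have := hg n
    omega

/-- Every word of `P` has an interior run of length one. -/
theorem exists_isolated_digit_of_mem_Pwords :
    ∀ w ∈ Pwords, ∃ i < w.length, i + 2 < w.length ∧
      w.getD i 0 ≠ w.getD (i + 1) 0 ∧ w.getD (i + 1) 0 ≠ w.getD (i + 2) 0 := by
  decide

theorem isBlockSeq.avoidsP {g : ℕ → ℕ} (hg : isBlockSeq g) : avoidsP g := by
  rintro w hw ⟨k, hk⟩
  obtain ⟨i, hi, hi2, h1, h2⟩ := exists_isolated_digit_of_mem_Pwords w hw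
  rw [← hk i hi, ← hk (i + 1) (by omega)] at h1
  rw [← hk (i + 1) (by omega), ← hk (i + 2) hi2] at h2
  exact (hg.eq_or_eq (k + i)).elim h1 h2

theorem Kset_subset_Yset : Kset ⊆ Yset := by
  rintro x ⟨g, hg, rfl⟩
  exact ⟨g, hg.eq_one_or_eq_two, hg.avoidsP, rfl⟩

/-- concatenations of the blocks `(1,1)` and `(2,2)` avoid `P`;
consequently `K({1_2, 2_2}) ⊆ Y` and `HD(Y) ≥ HD(K({1_2, 2_2}))`. -/
theorem K_subset_Y :
    (∀ g : ℕ → ℕ, isBlockSeq g → ∀ w ∈ Pwords, ¬ occursInN w g) ∧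
    Kset ⊆ Yset ∧ dimH Kset ≤ dimH Yset :=
  ⟨fun _ hg => hg.avoidsP, Kset_subset_Yset, dimH_mono Kset_subset_Yset⟩
end
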